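/- arXiv:1707.05966 — 2 statements merged into one kernel-verified Lean document; each statement's English description precedes it below -/
import Mathlib

section
/- Let n ≥ 1. There exists a constant C ≥ 1 such that for every ball B ⊂ ℝ^n, C^{-1}(‖χ_B‖_{L^{φ_0}}^{-1} + ‖χ_B‖_{L^1_{W_1}}^{-1}) ≤ ‖χ_B‖_{L^{Φ_1}}^{-1} ≤ C(‖χ_B‖_{L^{φ_0}}^{-1} + ‖χ_B‖_{L^1_{W_1}}^{-1}). -/
open MeasureTheory Real
open scoped ENNReal Classical

noncomputable section

/-- `ℝⁿ` as a Euclidean space. -/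
abbrev Rn (n : ℕ) := EuclideanSpace ℝ (Fin n)

/-- The Musielak-Orlicz growth function `Φ_p`. -/
def Phi (n : ℕ) (p : ℝ) (x : Rn n) (t : ℝ) : ℝ :=
  if ∃ k : ℕ, (n : ℝ) * (1 / p - 1) = (k : ℝ) then
    t / (Real.log (Real.exp 1 + t) +
      (t * (1 + ‖x‖) ^ (n : ℝ)) ^ (1 - p) * (Real.log (Real.exp 1 + ‖x‖)) ^ p)
  else
    t / (Real.log (Real.exp 1 + t) + (t * (1 + ‖x‖) ^ (n : ℝ)) ^ (1 - p))

/-- The Orlicz function `φ₀(t) = t / log(e+t)`. -/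
def phi0 (t : ℝ) : ℝ := t / Real.log (Real.exp 1 + t)

/-- The weight `W_p`. -/
def Wp (n : ℕ) (p : ℝ) (x : Rn n) : ℝ :=
  if p = 1 then 1 / Real.log (Real.exp 1 + ‖x‖)
  else if ∃ k : ℕ, (n : ℝ) * (1 / p - 1) = (k : ℝ) then
    (1 + ‖x‖) ^ (-(n : ℝ) * (1 - p)) * (Real.log (Real.exp 1 + ‖x‖)) ^ (-p)
  else (1 + ‖x‖) ^ (-(n : ℝ) * (1 - p))

/-- Extension of `Φ_p(x, ·)` to `ℝ≥0∞`. -/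
def PhiE (n : ℕ) (p : ℝ) (x : Rn n) (t : ℝ≥0∞) : ℝ≥0∞ :=
  if t = ⊤ then ⊤ else ENNReal.ofReal (Phi n p x t.toReal)

/-- Extension of `φ₀` to `ℝ≥0∞`. -/
def phi0E (t : ℝ≥0∞) : ℝ≥0∞ :=
  if t = ⊤ then ⊤ else ENNReal.ofReal (phi0 t.toReal)

/-- The Luxemburg quasi-norm `‖·‖_{L^{Φ_p}}`. -/
def luxPhiNorm (n : ℕ) (p : ℝ) (F : Rn n → ℝ≥0∞) : ℝ≥0∞ :=
  sInf {lam : ℝ≥0∞ | 0 < lam ∧ (∫⁻ x : Rn n, PhiE n p x (F x / lam)) ≤ 1}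

/-- The Luxemburg norm `‖·‖_{L^{φ₀}}`. -/
def luxPhi0Norm (n : ℕ) (F : Rn n → ℝ≥0∞) : ℝ≥0∞ :=
  sInf {lam : ℝ≥0∞ | 0 < lam ∧ (∫⁻ x : Rn n, phi0E (F x / lam)) ≤ 1}

/-- The weighted quasi-norm `‖·‖_{L^p_{W_p}}`. -/
def wNorm (n : ℕ) (p : ℝ) (F : Rn n → ℝ≥0∞) : ℝ≥0∞ :=
  (∫⁻ x : Rn n, F x ^ p * ENNReal.ofReal (Wp n p x)) ^ (1 / p)

/-- The weighted norm `‖·‖_{L^1_{W_1}}`. -/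
def w1Norm (n : ℕ) (F : Rn n → ℝ≥0∞) : ℝ≥0∞ :=
  ∫⁻ x : Rn n, F x * ENNReal.ofReal (Wp n 1 x)

/-- The characteristic function of a set, `ℝ≥0∞`-valued. -/
def chi (n : ℕ) (B : Set (Rn n)) : Rn n → ℝ≥0∞ := B.indicator fun _ => 1


lemma one_le_log_exp_one_add {t : ℝ} (ht : 0 ≤ t) : 1 ≤ Real.log (Real.exp 1 + t) := by
  rw [Real.le_log_iff_exp_le (by positivity)]
  linarith

lemma log_exp_one_add_mono {s t : ℝ} (hs : 0 ≤ s) (hst : s ≤ t) :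
    Real.log (Real.exp 1 + s) ≤ Real.log (Real.exp 1 + t) :=
  Real.log_le_log (by positivity) (by linarith)

lemma log_exp_one_add_mul_le {m t : ℝ} (hm : 1 ≤ m) (ht : 0 ≤ t) :
    Real.log (Real.exp 1 + m * t) ≤ (1 + Real.log m) * Real.log (Real.exp 1 + t) := by
  have h1 := one_le_log_exp_one_add ht
  have h2 : Real.log (Real.exp 1 + m * t) ≤ Real.log (m * (Real.exp 1 + t)) := by
    apply Real.log_le_log (by positivity)
    nlinarith [Real.exp_pos 1]
  rw [Real.log_mul (by positivity) (by positivity)] at h2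
  nlinarith [Real.log_nonneg hm]

lemma phi0_div_eight_le {t : ℝ} (ht : 0 ≤ t) : phi0 (t / 8) ≤ phi0 t / 2 := by
  have h1 := one_le_log_exp_one_add ht
  have h2 := one_le_log_exp_one_add (show 0 ≤ t / 8 by positivity)
  have h3 := log_exp_one_add_mul_le (m := 8) (by norm_num) (show 0 ≤ t / 8 by positivity)
  have h4 : Real.log 8 ≤ 3 := by
    rw [show (8 : ℝ) = 2 ^ 3 by norm_num, Real.log_pow]
    have := Real.log_two_lt_d9
    push_cast
    linarith
  rw [show 8 * (t / 8) = t by ring] at h3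
  unfold phi0
  rw [div_div, div_div, div_le_div_iff₀ (by positivity) (by positivity)]
  apply mul_le_mul_of_nonneg_left _ ht
  nlinarith

lemma Phi_one (n : ℕ) (x : Rn n) (t : ℝ) :
    Phi n 1 x t = t / (Real.log (Real.exp 1 + t) + Real.log (Real.exp 1 + ‖x‖)) := by
  have h : ∃ k : ℕ, (n : ℝ) * (1 / 1 - 1) = (k : ℝ) := ⟨0, by simp⟩
  simp only [Phi, if_pos h, sub_self, Real.rpow_zero, Real.rpow_one, one_mul]

lemma Wp_one (n : ℕ) (x : Rn n) : Wp n 1 x = 1 / Real.log (Real.exp 1 + ‖x‖) := by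
  simp [Wp]

lemma PhiE_one_le_phi0E (n : ℕ) (x : Rn n) (t : ℝ≥0∞) : PhiE n 1 x t ≤ phi0E t := by
  unfold PhiE phi0E
  split_ifs
  · exact le_rfl
  · rw [Phi_one, phi0]
    apply ENNReal.ofReal_le_ofReal
    have h1 := one_le_log_exp_one_add (t := t.toReal) ENNReal.toReal_nonneg
    have h2 := one_le_log_exp_one_add (norm_nonneg x)
    gcongr
    linarith

lemma PhiE_one_le_mul_Wp (n : ℕ) (x : Rn n) (t : ℝ≥0∞) :
    PhiE n 1 x t ≤ t * ENNReal.ofReal (Wp n 1 x) := by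
  have h2 := one_le_log_exp_one_add (norm_nonneg x)
  unfold PhiE
  split_ifs with h
  · rw [h, ENNReal.top_mul]
    rw [Wp_one]
    simp only [ne_eq, ENNReal.ofReal_eq_zero, not_le]
    positivity
  · conv_rhs => rw [← ENNReal.ofReal_toReal h, ← ENNReal.ofReal_mul ENNReal.toReal_nonneg]
    rw [Phi_one, Wp_one, mul_one_div]
    apply ENNReal.ofReal_le_ofReal
    have h1 := one_le_log_exp_one_add (t := t.toReal) ENNReal.toReal_nonneg
    gcongr
    linarith

lemma luxPhiNorm_one_le_luxPhi0Norm (n : ℕ) (F : Rn n → ℝ≥0∞) :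
    luxPhiNorm n 1 F ≤ luxPhi0Norm n F :=
  sInf_le_sInf fun _ h =>
    ⟨h.1, (lintegral_mono fun x => PhiE_one_le_phi0E n x _).trans h.2⟩

lemma luxPhiNorm_one_le_w1Norm (n : ℕ) (F : Rn n → ℝ≥0∞) :
    luxPhiNorm n 1 F ≤ w1Norm n F := by
  refine le_of_forall_gt fun lam hlam => ?_
  obtain ⟨lam', h1, h2⟩ := exists_between hlam
  have hpos : 0 < lam' := pos_of_gt h1
  refine lt_of_le_of_lt (sInf_le ⟨hpos, ?_⟩) h2
  calc ∫⁻ x, PhiE n 1 x (F x / lam')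
      ≤ ∫⁻ x, F x * ENNReal.ofReal (Wp n 1 x) * lam'⁻¹ := by
        refine lintegral_mono fun x => (PhiE_one_le_mul_Wp n x _).trans_eq ?_
        rw [div_eq_mul_inv, mul_right_comm]
    _ = w1Norm n F / lam' := by
        rw [lintegral_mul_const' _ _ (ENNReal.inv_ne_top.2 hpos.ne'), ← div_eq_mul_inv, w1Norm]
    _ ≤ 1 := ENNReal.div_le_of_le_mul (by rw [one_mul]; exact h1.le)

lemma lintegral_phi0E_chi_div {n : ℕ} {B : Set (Rn n)} (hB : MeasurableSet B) (lam : ℝ≥0∞) :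
    ∫⁻ x, phi0E (chi n B x / lam) = phi0E lam⁻¹ * volume B := by
  have h : ∀ x, phi0E (chi n B x / lam) = B.indicator (fun _ => phi0E lam⁻¹) x := by
    intro x
    by_cases hx : x ∈ B
    · simp [chi, hx]
    · simp [chi, hx, phi0E, phi0]
  simp_rw [h]
  rw [lintegral_indicator_const hB]

lemma le_lintegral_PhiE_chi_div {n : ℕ} {c : Rn n} {r : ℝ} {lam : ℝ≥0∞} (hlam : lam ≠ 0) :
    ENNReal.ofReal ((lam⁻¹).toReal / (Real.log (Real.exp 1 + (lam⁻¹).toReal) +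
        Real.log (Real.exp 1 + (‖c‖ + r)))) * volume (Metric.ball c r) ≤
      ∫⁻ x, PhiE n 1 x (chi n (Metric.ball c r) x / lam) := by
  rw [← lintegral_indicator_const measurableSet_ball]
  refine lintegral_mono fun x => ?_
  by_cases hx : x ∈ Metric.ball c r
  · have h1 := one_le_log_exp_one_add (t := (lam⁻¹).toReal) ENNReal.toReal_nonneg
    have h2 := one_le_log_exp_one_add (norm_nonneg x)
    have h3 : ‖x‖ ≤ ‖c‖ + r := by
      rw [mem_ball_iff_norm] at hx
      linarith [norm_le_norm_add_norm_sub' x c]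
    have h4 := log_exp_one_add_mono (norm_nonneg x) h3
    simp only [Set.indicator_of_mem hx, chi, one_div, PhiE, if_neg (ENNReal.inv_ne_top.2 hlam),
      Phi_one]
    gcongr
  · simp [hx]

lemma w1Norm_chi {n : ℕ} {B : Set (Rn n)} (hB : MeasurableSet B) :
    w1Norm n (chi n B) = ∫⁻ x in B, ENNReal.ofReal (1 / Real.log (Real.exp 1 + ‖x‖)) := by
  rw [w1Norm, ← lintegral_indicator hB]
  congr 1 with x
  by_cases hx : x ∈ B <;> simp [chi, hx, Wp_one]

lemma sqrt_pow_mul_log_le {n : ℕ} (hn : 1 ≤ n) {r R : ℝ} (hR : 1 ≤ R) (hRr : R ≤ 3 * r) :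
    √(Real.exp 1 + R) ^ n * Real.log (Real.exp 1 + R) ≤ 4 * 6 ^ n * r ^ n := by
  have hs : 1 ≤ √R := Real.one_le_sqrt.2 hR
  have hss : √R * √R = R := Real.mul_self_sqrt (by linarith)
  have hρ : √(Real.exp 1 + R) ≤ 2 * √R := by
    rw [Real.sqrt_le_left (by positivity)]
    nlinarith [Real.exp_one_lt_d9]
  have hL : Real.log (Real.exp 1 + R) ≤ 4 * √R := by
    have h := Real.log_le_self (Real.sqrt_nonneg (Real.exp 1 + R))
    rw [Real.log_sqrt (by positivity)] at h
    linarith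
  have hpow : √R ^ n * √R ≤ (√R * √R) ^ n := by
    rw [mul_pow]
    gcongr
    exact le_self_pow₀ hs (by lia)
  calc √(Real.exp 1 + R) ^ n * Real.log (Real.exp 1 + R)
      ≤ (2 * √R) ^ n * (4 * √R) := by
        have := one_le_log_exp_one_add (show 0 ≤ R by linarith)
        gcongr
    _ = 4 * 2 ^ n * (√R ^ n * √R) := by ring
    _ ≤ 4 * 2 ^ n * (√R * √R) ^ n := by gcongr
    _ ≤ 4 * 2 ^ n * (3 * r) ^ n := by rw [hss]; gcongr
    _ = 4 * 6 ^ n * r ^ n := by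
        rw [mul_pow, show (6 : ℝ) = 2 * 3 by norm_num, mul_pow]; ring

lemma w1Norm_chi_ball_le {n : ℕ} (hn : 1 ≤ n) (c : Rn n) {r : ℝ} (hr : 0 < r) :
    w1Norm n (chi n (Metric.ball c r)) ≤
      ENNReal.ofReal (6 * 6 ^ n / Real.log (Real.exp 1 + (‖c‖ + r))) *
        volume (Metric.ball c r) := by
  rw [w1Norm_chi measurableSet_ball]
  have hc := norm_nonneg c
  have hL := one_le_log_exp_one_add (show 0 ≤ ‖c‖ + r by positivity)
  have h6 : (1 : ℝ) ≤ 6 ^ n := one_le_pow₀ (by norm_num)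
  set L := Real.log (Real.exp 1 + (‖c‖ + r)) with hLdef
  have of_pointwise (h : ∀ x ∈ Metric.ball c r, L ≤ 3 * Real.log (Real.exp 1 + ‖x‖)) :
      ∫⁻ x in Metric.ball c r, ENNReal.ofReal (1 / Real.log (Real.exp 1 + ‖x‖)) ≤
        ENNReal.ofReal (6 * 6 ^ n / L) * volume (Metric.ball c r) := by
    rw [← setLIntegral_const]
    refine setLIntegral_mono' measurableSet_ball fun x hx => ENNReal.ofReal_le_ofReal ?_
    have h1 := one_le_log_exp_one_add (norm_nonneg x)
    rw [div_le_div_iff₀ (by positivity) (by positivity)]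
    nlinarith [h x hx]
  rcases le_or_gt (2 * r) ‖c‖ with hcr | hcr
  · refine of_pointwise fun x hx => ?_
    rw [mem_ball_iff_norm'] at hx
    have hx' : ‖c‖ + r ≤ 3 * ‖x‖ := by linarith [norm_le_norm_add_norm_sub' c x]
    have h1 := one_le_log_exp_one_add (norm_nonneg x)
    have h2 := log_exp_one_add_mul_le (m := 3) (by norm_num) (norm_nonneg x)
    have h3 := log_exp_one_add_mono (by positivity) hx'
    have h4 := Real.log_le_sub_one_of_pos (show (0 : ℝ) < 3 by norm_num)
    nlinarith
  rcases le_or_gt (‖c‖ + r) 1 with hR | hR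
  · refine of_pointwise fun x _ => ?_
    have h1 := one_le_log_exp_one_add (norm_nonneg x)
    have h2 := log_exp_one_add_mono (by positivity) hR
    have h3 : Real.log (Real.exp 1 + 1) ≤ 3 := by
      have := Real.log_le_sub_one_of_pos (show (0 : ℝ) < Real.exp 1 + 1 by positivity)
      linarith [Real.exp_one_lt_d9]
    linarith
  · set ρ := √(Real.exp 1 + (‖c‖ + r)) with hρ
    have hpow : ρ ^ n ≤ 4 * 6 ^ n / L * r ^ n := by
      rw [div_mul_eq_mul_div, le_div_iff₀ (by positivity)]
      exact sqrt_pow_mul_log_le hn hR.le (by linarith)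
    have hball : volume (Metric.ball (0 : Rn n) ρ) ≤
        ENNReal.ofReal (4 * 6 ^ n / L) * volume (Metric.ball c r) := by
      rw [Measure.addHaar_ball_of_pos volume 0 (by positivity),
        Measure.addHaar_ball_of_pos volume c hr, ← mul_assoc, ← ENNReal.ofReal_mul (by positivity), finrank_euclideanSpace_fin]
      gcongr
    have hpt : ∀ x : Rn n, ENNReal.ofReal (1 / Real.log (Real.exp 1 + ‖x‖)) ≤
        ENNReal.ofReal (2 / L) + (Metric.ball (0 : Rn n) ρ).indicator (fun _ => 1) x := by
      intro x
      have h1 := one_le_log_exp_one_add (norm_nonneg x)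
      by_cases hx : x ∈ Metric.ball (0 : Rn n) ρ
      · rw [Set.indicator_of_mem hx]
        refine le_add_left ?_
        rw [ENNReal.ofReal_le_one]
        exact div_le_one_of_le₀ h1 (by positivity)
      · refine le_add_right (ENNReal.ofReal_le_ofReal ?_)
        rw [mem_ball_zero_iff, not_lt] at hx
        have h2 : L ≤ 2 * Real.log (Real.exp 1 + ‖x‖) := by
          have h3 : Real.log ρ ≤ Real.log (Real.exp 1 + ‖x‖) :=
            Real.log_le_log (by positivity) (by linarith [Real.exp_pos 1])
          rw [hρ, Real.log_sqrt (by positivity)] at h3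
          linarith
        rw [div_le_div_iff₀ (by positivity) (by positivity)]
        linarith
    calc ∫⁻ x in Metric.ball c r, ENNReal.ofReal (1 / Real.log (Real.exp 1 + ‖x‖))
        ≤ ∫⁻ x in Metric.ball c r, (ENNReal.ofReal (2 / L) +
            (Metric.ball (0 : Rn n) ρ).indicator (fun _ => 1) x) := lintegral_mono hpt
      _ ≤ ENNReal.ofReal (2 / L) * volume (Metric.ball c r) +
            volume (Metric.ball (0 : Rn n) ρ) := by
          rw [lintegral_add_left measurable_const, setLIntegral_const]
          gcongr
          refine (setLIntegral_le_lintegral _ _).trans_eq ?_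
          rw [lintegral_indicator_const measurableSet_ball, one_mul]
      _ ≤ ENNReal.ofReal (2 / L) * volume (Metric.ball c r) +
            ENNReal.ofReal (4 * 6 ^ n / L) * volume (Metric.ball c r) := by gcongr
      _ ≤ ENNReal.ofReal (6 * 6 ^ n / L) * volume (Metric.ball c r) := by
          rw [← add_mul, ← ENNReal.ofReal_add (by positivity) (by positivity), ← add_div]
          gcongr
          linarith

lemma luxPhi0Norm_le_or_w1Norm_le {n : ℕ} (hn : 1 ≤ n) (c : Rn n) {r : ℝ} (hr : 0 < r)
    {lam : ℝ≥0∞} (hpos : 0 < lam) (htop : lam ≠ ⊤)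
    (hlam : ∫⁻ x, PhiE n 1 x (chi n (Metric.ball c r) x / lam) ≤ 1) :
    luxPhi0Norm n (chi n (Metric.ball c r)) ≤ ENNReal.ofReal (12 * 6 ^ n) * lam ∨
      w1Norm n (chi n (Metric.ball c r)) ≤ ENNReal.ofReal (12 * 6 ^ n) * lam := by
  have h6 : (1 : ℝ) ≤ 6 ^ n := one_le_pow₀ (by norm_num)
  have hle := (le_lintegral_PhiE_chi_div hpos.ne').trans hlam
  set t := (lam⁻¹).toReal with ht
  have ht0 : 0 < t :=
    ENNReal.toReal_pos (ENNReal.inv_ne_zero.2 htop) (ENNReal.inv_ne_top.2 hpos.ne')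
  have hlt : lam = ENNReal.ofReal t⁻¹ := by
    rw [ht, ENNReal.toReal_inv, inv_inv, ENNReal.ofReal_toReal htop]
  have hc := norm_nonneg c
  have hL := one_le_log_exp_one_add (show 0 ≤ ‖c‖ + r by positivity)
  have hT := one_le_log_exp_one_add ht0.le
  rcases le_total (Real.log (Real.exp 1 + (‖c‖ + r))) (Real.log (Real.exp 1 + t)) with h | h
  · left
    have hmem : luxPhi0Norm n (chi n (Metric.ball c r)) ≤ ENNReal.ofReal (8 * t⁻¹) := by
      have hpos8 : 0 < ENNReal.ofReal (8 * t⁻¹) := ENNReal.ofReal_pos.2 (by positivity)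
      refine sInf_le ⟨hpos8, ?_⟩
      rw [lintegral_phi0E_chi_div measurableSet_ball, phi0E,
        if_neg (ENNReal.inv_ne_top.2 hpos8.ne'), ENNReal.toReal_inv,
        ENNReal.toReal_ofReal (by positivity), show (8 * t⁻¹)⁻¹ = t / 8 by field_simp]
      refine le_trans ?_ hle
      gcongr
      refine (phi0_div_eight_le ht0.le).trans ?_
      rw [phi0, div_div]
      gcongr
      linarith
    refine hmem.trans ?_
    rw [hlt, ← ENNReal.ofReal_mul (by positivity)]
    gcongr
    linarith
  · right
    refine (w1Norm_chi_ball_le hn c hr).trans ?_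
    calc _ ≤ ENNReal.ofReal (12 * 6 ^ n) * lam * (ENNReal.ofReal (t /
              (Real.log (Real.exp 1 + t) + Real.log (Real.exp 1 + (‖c‖ + r)))) *
              volume (Metric.ball c r)) := by
          rw [hlt, ← mul_assoc, ← ENNReal.ofReal_mul (by positivity),
            ← ENNReal.ofReal_mul (by positivity)]
          gcongr
          rw [← mul_div_assoc, mul_assoc, inv_mul_cancel₀ ht0.ne', mul_one,
            div_le_div_iff₀ (by positivity) (by positivity)]
          nlinarith
      _ ≤ ENNReal.ofReal (12 * 6 ^ n) * lam * 1 := by gcongr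
      _ = _ := mul_one _

/-- `‖χ_B‖_{L^{Φ_1}}⁻¹ ∼ ‖χ_B‖_{L^{φ₀}}⁻¹ + ‖χ_B‖_{L^1_{W_1}}⁻¹`. -/
theorem statement8 (n : ℕ) (hn : 1 ≤ n) :
    ∃ C : ℝ≥0∞, 1 ≤ C ∧ C ≠ ⊤ ∧ ∀ (c : Rn n) (r : ℝ), 0 < r →
      C⁻¹ * ((luxPhi0Norm n (chi n (Metric.ball c r)))⁻¹ +
          (w1Norm n (chi n (Metric.ball c r)))⁻¹) ≤
        (luxPhiNorm n 1 (chi n (Metric.ball c r)))⁻¹ ∧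
      (luxPhiNorm n 1 (chi n (Metric.ball c r)))⁻¹ ≤
        C * ((luxPhi0Norm n (chi n (Metric.ball c r)))⁻¹ +
          (w1Norm n (chi n (Metric.ball c r)))⁻¹) := by
  have h6 : (1 : ℝ) ≤ 6 ^ n := one_le_pow₀ (by norm_num)
  have h2C : (2 : ℝ≥0∞) ≤ ENNReal.ofReal (12 * 6 ^ n) := by
    rw [← ENNReal.ofReal_ofNat]
    exact ENNReal.ofReal_le_ofReal (by linarith)
  have hC0 : ENNReal.ofReal (12 * 6 ^ n) ≠ 0 := (zero_lt_two.trans_le h2C).ne'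
  refine ⟨ENNReal.ofReal (12 * 6 ^ n), one_le_two.trans h2C, ENNReal.ofReal_ne_top,
    fun c r hr => ⟨?_, ?_⟩⟩
  · calc _ ≤ 2⁻¹ * ((luxPhiNorm n 1 (chi n (Metric.ball c r)))⁻¹ +
            (luxPhiNorm n 1 (chi n (Metric.ball c r)))⁻¹) := by
          gcongr
          · exact luxPhiNorm_one_le_luxPhi0Norm n _
          · exact luxPhiNorm_one_le_w1Norm n _
      _ = _ := by
          rw [← two_mul, ← mul_assoc, ENNReal.inv_mul_cancel two_ne_zero ENNReal.ofNat_ne_top,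
            one_mul]
  · rw [ENNReal.inv_le_iff_inv_le]
    refine le_sInf fun lam ⟨hpos, hlam⟩ => ?_
    rcases eq_or_ne lam ⊤ with rfl | htop
    · exact le_top
    have key {X : ℝ≥0∞} (hX : X ≤ ENNReal.ofReal (12 * 6 ^ n) * lam) :
        lam⁻¹ ≤ ENNReal.ofReal (12 * 6 ^ n) * X⁻¹ := by
      calc lam⁻¹ = ENNReal.ofReal (12 * 6 ^ n) * (ENNReal.ofReal (12 * 6 ^ n) * lam)⁻¹ := by
            rw [ENNReal.mul_inv (.inl hC0) (.inl ENNReal.ofReal_ne_top), ← mul_assoc,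
              ENNReal.mul_inv_cancel hC0 ENNReal.ofReal_ne_top, one_mul]
        _ ≤ _ := by gcongr
    rw [ENNReal.inv_le_iff_inv_le]
    rcases luxPhi0Norm_le_or_w1Norm_le hn c hr hpos htop hlam with h | h
    · exact (key h).trans (by gcongr; exact le_self_add)
    · exact (key h).trans (by gcongr; exact le_add_self)
end
end

section
/- Let n ≥ 1 and p ∈ (0,1). There exists a constant C ≥ 1 such that for every ball B ⊂ ℝ^n, C^{-1}‖χ_B‖_{L^{Φ_p}} ≤ (∫_B W_p(x) dx)^{1/p} ≤ C‖χ_B‖_{L^{Φ_p}}, i.e., ‖χ_B‖_{L^p_{W_p}} and ‖χ_B‖_{L^{Φ_p}} are comparable with constants independent of B. -/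
open MeasureTheory Real
open scoped ENNReal Classical

noncomputable section

lemma Wp_pos {n : ℕ} {p : ℝ} (x : Rn n) : 0 < Wp n p x := by
  have h : 0 < Real.log (Real.exp 1 + ‖x‖) :=
    zero_lt_one.trans_le (one_le_log_exp_one_add (norm_nonneg x))
  unfold Wp
  split_ifs <;> positivity

lemma Wp_le {n : ℕ} {p : ℝ} (hp0 : 0 < p) (hp1 : p < 1) (x : Rn n) :
    Wp n p x ≤ (1 + ‖x‖) ^ (-(n : ℝ) * (1 - p)) := by
  unfold Wp
  rw [if_neg hp1.ne]
  split_ifs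
  · exact mul_le_of_le_one_right (by positivity) (Real.rpow_le_one_of_one_le_of_nonpos
      (one_le_log_exp_one_add (norm_nonneg x)) (by linarith))
  · exact le_rfl

lemma Wp_le_one {n : ℕ} {p : ℝ} (hp0 : 0 < p) (hp1 : p < 1) (x : Rn n) : Wp n p x ≤ 1 := by
  refine (Wp_le hp0 hp1 x).trans (Real.rpow_le_one_of_one_le_of_nonpos ?_ ?_)
  · linarith [norm_nonneg x]
  · have : (0 : ℝ) ≤ n * (1 - p) := mul_nonneg n.cast_nonneg (by linarith)
    linarith

lemma Phi_eq {n : ℕ} {p : ℝ} (hp1 : p < 1) (x : Rn n) {t : ℝ} (ht : 0 ≤ t) :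
    Phi n p x t = t / (Real.log (Real.exp 1 + t) + t ^ (1 - p) / Wp n p x) := by
  have hl : 0 ≤ Real.log (Real.exp 1 + ‖x‖) :=
    zero_le_one.trans (one_le_log_exp_one_add (norm_nonneg x))
  have hx : (0 : ℝ) ≤ 1 + ‖x‖ := by positivity
  unfold Phi Wp
  rw [if_neg hp1.ne, Real.mul_rpow ht (by positivity), ← Real.rpow_mul hx, neg_mul,
    Real.rpow_neg hx, Real.rpow_neg hl]
  split_ifs <;> congr 2
  · rw [← mul_inv, div_inv_eq_mul, mul_assoc]
  · rw [div_inv_eq_mul]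

lemma Phi_le {n : ℕ} {p : ℝ} (hp1 : p < 1) (x : Rn n) {t : ℝ} (ht : 0 < t) :
    Phi n p x t ≤ t ^ p * Wp n p x := by
  have hW := Wp_pos (p := p) x
  have hl := one_le_log_exp_one_add ht.le
  rw [Phi_eq hp1 x ht.le, div_le_iff₀ (by positivity)]
  have h : t ^ p * t ^ (1 - p) = t := by
    rw [← Real.rpow_add ht, add_sub_cancel, Real.rpow_one]
  calc t = t ^ p * Wp n p x * (t ^ (1 - p) / Wp n p x) := by
        field_simp
        exact h.symm
    _ ≤ _ := by
        gcongr
        linarith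

lemma log_exp_one_add_le {n : ℕ} {p : ℝ} (hp0 : 0 < p) (hp1 : p < 1) (x : Rn n) {t : ℝ}
    (ht : 0 < t) (h : 1 ≤ t ∨ 1 ≤ t * (1 + ‖x‖) ^ (n : ℝ)) :
    Real.log (Real.exp 1 + t) ≤ 4 / (1 - p) * (t ^ (1 - p) / Wp n p x) := by
  have hq : 0 < 1 - p := by linarith
  have hW := Wp_pos (p := p) x
  have he : Real.exp 1 < 3 := by linarith [Real.exp_one_lt_d9]
  rcases le_or_gt 1 t with h1 | h1
  · calc Real.log (Real.exp 1 + t) ≤ Real.log (4 * t) :=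
          Real.log_le_log (by positivity) (by linarith)
      _ ≤ (4 * t) ^ (1 - p) / (1 - p) := Real.log_le_rpow_div (by positivity) hq
      _ = 4 ^ (1 - p) / (1 - p) * t ^ (1 - p) := by
          rw [Real.mul_rpow (by norm_num) ht.le]
          ring
      _ ≤ 4 / (1 - p) * (t ^ (1 - p) / Wp n p x) := by
          gcongr
          · exact Real.rpow_le_self_of_one_le (by norm_num) (by linarith)
          · exact le_div_self (by positivity) hW (Wp_le_one hp0 hp1 x)
  · replace h := h.resolve_left h1.not_ge
    have hx : (0 : ℝ) ≤ 1 + ‖x‖ := by positivity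
    have hlog : Real.log (Real.exp 1 + t) ≤ 4 := by
      linarith [Real.log_le_sub_one_of_pos (show 0 < Real.exp 1 + t by positivity)]
    have h4 : 4 ≤ 4 / (1 - p) := le_div_self (by norm_num) hq (by linarith)
    have hone : 1 ≤ t ^ (1 - p) / Wp n p x := by
      rw [one_le_div hW]
      refine (Wp_le hp0 hp1 x).trans ?_
      rw [neg_mul, Real.rpow_neg hx, inv_le_iff_one_le_mul₀ (by positivity), Real.rpow_mul hx,
        ← Real.mul_rpow ht.le (by positivity)]
      exact Real.one_le_rpow h hq.le
    nlinarith

lemma rpow_mul_Wp_le {n : ℕ} {p : ℝ} (hp0 : 0 < p) (hp1 : p < 1) (x : Rn n) {t : ℝ}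
    (ht : 0 < t) (h : 1 ≤ t ∨ 1 ≤ t * (1 + ‖x‖) ^ (n : ℝ)) :
    t ^ p * Wp n p x ≤ (4 / (1 - p) + 1) * Phi n p x t := by
  have hW := Wp_pos (p := p) x
  have hl := one_le_log_exp_one_add ht.le
  have hlog := log_exp_one_add_le hp0 hp1 x ht h
  rw [Phi_eq hp1 x ht.le, ← mul_div_assoc, le_div_iff₀ (by positivity)]
  have h' : t ^ p * t ^ (1 - p) = t := by
    rw [← Real.rpow_add ht, add_sub_cancel, Real.rpow_one]
  calc t ^ p * Wp n p x * (Real.log (Real.exp 1 + t) + t ^ (1 - p) / Wp n p x)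
      ≤ t ^ p * Wp n p x * ((4 / (1 - p) + 1) * (t ^ (1 - p) / Wp n p x)) := by
        gcongr
        linarith
    _ = (4 / (1 - p) + 1) * (t ^ p * t ^ (1 - p)) := by field_simp
    _ = (4 / (1 - p) + 1) * t := by rw [h']

lemma rpow_mul_Wp_le_of_small {n : ℕ} (hn : 1 ≤ n) {p : ℝ} (hp0 : 0 < p) (hp1 : p < 1)
    {x : Rn n} (hx : x ≠ 0) {t : ℝ} (ht : 0 < t) :
    t ^ p * Wp n p x ≤ t * ‖t ^ (1 / (n : ℝ)) • x‖ ^ (-((n : ℝ) * (1 - p))) := by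
  have hn0 : (0 : ℝ) < n := by exact_mod_cast hn
  have hx0 : 0 < ‖x‖ := norm_pos_iff.mpr hx
  have ha : 0 ≤ (n : ℝ) * (1 - p) := mul_nonneg hn0.le (by linarith)
  rw [norm_smul, Real.norm_of_nonneg (by positivity), Real.mul_rpow (by positivity) hx0.le,
    ← Real.rpow_mul ht.le, ← mul_assoc]
  have h : t * t ^ (1 / (n : ℝ) * -((n : ℝ) * (1 - p))) = t ^ p := by
    have : 1 / (n : ℝ) * -((n : ℝ) * (1 - p)) = p - 1 := by field_simp; ring
    rw [this, ← Real.rpow_one_add' ht.le (by linarith), add_sub_cancel]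
  rw [h]
  gcongr
  refine (Wp_le hp0 hp1 x).trans ?_
  rw [neg_mul]
  exact Real.rpow_le_rpow_of_nonpos hx0 (by linarith) (by linarith)

lemma norm_smul_lt_one {n : ℕ} (hn : 1 ≤ n) {x : Rn n} {t : ℝ} (ht : 0 < t)
    (h : t * (1 + ‖x‖) ^ (n : ℝ) < 1) : ‖t ^ (1 / (n : ℝ)) • x‖ < 1 := by
  have hn0 : (0 : ℝ) < n := by exact_mod_cast hn
  have hs : 0 < t ^ (1 / (n : ℝ)) := by positivity
  rw [norm_smul, Real.norm_of_nonneg hs.le]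
  calc t ^ (1 / (n : ℝ)) * ‖x‖ < t ^ (1 / (n : ℝ)) * (1 + ‖x‖) := by
        gcongr
        linarith
    _ = (t * (1 + ‖x‖) ^ (n : ℝ)) ^ (1 / (n : ℝ)) := by
        rw [Real.mul_rpow ht.le (by positivity), ← Real.rpow_mul (by positivity),
          mul_one_div_cancel hn0.ne', Real.rpow_one]
    _ < 1 := Real.rpow_lt_one (by positivity) h (by positivity)

/-- The profile `‖y‖^{-n(1-p)}` on the unit ball, which dominates the rescaled weight. -/
def ballPow (n : ℕ) (p : ℝ) : Rn n → ℝ≥0∞ :=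
  (Metric.ball 0 1).indicator fun y => ENNReal.ofReal (‖y‖ ^ (-((n : ℝ) * (1 - p))))

lemma measurable_ballPow (n : ℕ) (p : ℝ) : Measurable (ballPow n p) :=
  Measurable.indicator (by fun_prop) measurableSet_ball

lemma lintegral_ballPow_ne_top {n : ℕ} (hn : 1 ≤ n) {p : ℝ} (hp0 : 0 < p) :
    ∫⁻ y, ballPow n p y ≠ ⊤ := by
  have hn0 : (0 : ℝ) < n := by exact_mod_cast hn
  have hint : IntegrableOn (fun y : Rn n => ‖y‖ ^ (-((n : ℝ) * (1 - p)))) (Metric.ball 0 1) := by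
    refine integrableOn_ball_of_norm_le_rpow (C := 1) (α := (n : ℝ) * (1 - p)) (by simpa) ?_
      (.of_forall fun y => ?_) (Measurable.aestronglyMeasurable (by fun_prop))
    · simpa using by nlinarith
    · rw [one_mul, Real.norm_of_nonneg (by positivity)]
  unfold ballPow
  rw [lintegral_indicator measurableSet_ball]
  exact hint.lintegral_lt_top.ne

lemma lintegral_ballPow_smul {n : ℕ} (hn : 1 ≤ n) (p : ℝ) {t : ℝ} (ht : 0 < t) :
    ∫⁻ x, ENNReal.ofReal t * ballPow n p (t ^ (1 / (n : ℝ)) • x) = ∫⁻ y, ballPow n p y := by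
  have hn0 : (0 : ℝ) < n := by exact_mod_cast hn
  have hs : t ^ (1 / (n : ℝ)) ≠ 0 := by positivity
  have hpow : (t ^ (1 / (n : ℝ))) ^ n = t := by
    rw [← Real.rpow_natCast, ← Real.rpow_mul ht.le, one_div_mul_cancel hn0.ne', Real.rpow_one]
  rw [lintegral_const_mul' _ _ ENNReal.ofReal_ne_top,
    ← lintegral_map (measurable_ballPow n p) (measurable_const_smul _),
    Measure.map_addHaar_smul _ hs, lintegral_smul_measure, finrank_euclideanSpace_fin, hpow,
    abs_of_pos (inv_pos.mpr ht), smul_eq_mul, ← mul_assoc, ← ENNReal.ofReal_mul ht.le,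
    mul_inv_cancel₀ ht.ne', ENNReal.ofReal_one, one_mul]

/-- The modular of `t χ_B` controls `t ^ p ∫_B W_p` up to an additive constant,
uniformly in `B` and the height `t`. -/
lemma rpow_mul_lintegral_Wp_le {n : ℕ} (hn : 1 ≤ n) {p : ℝ} (hp0 : 0 < p) (hp1 : p < 1)
    (B : Set (Rn n)) {t : ℝ} (ht : 0 < t) :
    ENNReal.ofReal (t ^ p) * ∫⁻ x in B, ENNReal.ofReal (Wp n p x) ≤
      (∫⁻ y, ballPow n p y) +
        ENNReal.ofReal (4 / (1 - p) + 1) * ∫⁻ x in B, ENNReal.ofReal (Phi n p x t) := by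
  have : Nontrivial (Rn n) := Module.nontrivial_of_finrank_pos (R := ℝ) (by simpa)
  rw [← lintegral_const_mul' _ _ ENNReal.ofReal_ne_top,
    ← lintegral_const_mul' _ _ ENNReal.ofReal_ne_top, ← lintegral_ballPow_smul hn p ht]
  grw [← setLIntegral_le_lintegral B]
  have hmeas : Measurable fun x : Rn n =>
      ENNReal.ofReal t * ballPow n p (t ^ (1 / (n : ℝ)) • x) :=
    ((measurable_ballPow n p).comp (measurable_const_smul _)).const_mul _
  rw [← lintegral_add_left hmeas]
  refine lintegral_mono_ae (ae_restrict_of_ae ?_)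
  filter_upwards [Measure.ae_ne volume (0 : Rn n)] with x hx
  by_cases h : 1 ≤ t ∨ 1 ≤ t * (1 + ‖x‖) ^ (n : ℝ)
  · refine le_add_left ?_
    rw [← ENNReal.ofReal_mul (by positivity), ← ENNReal.ofReal_mul
      (add_nonneg (div_nonneg (by norm_num) (by linarith)) zero_le_one)]
    exact ENNReal.ofReal_le_ofReal (rpow_mul_Wp_le hp0 hp1 x ht h)
  · refine le_add_right ?_
    have hmem : t ^ (1 / (n : ℝ)) • x ∈ Metric.ball (0 : Rn n) 1 :=
      mem_ball_zero_iff.mpr (norm_smul_lt_one hn ht (by push Not at h; exact h.2))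
    simp only [ballPow, Set.indicator_of_mem hmem]
    rw [← ENNReal.ofReal_mul (by positivity), ← ENNReal.ofReal_mul ht.le]
    exact ENNReal.ofReal_le_ofReal (rpow_mul_Wp_le_of_small hn hp0 hp1 hx ht)

lemma lintegral_PhiE_chi {n : ℕ} (p : ℝ) {B : Set (Rn n)} (hB : MeasurableSet B) {lam : ℝ≥0∞}
    (h0 : 0 < lam) :
    ∫⁻ x, PhiE n p x (chi n B x / lam) =
      ∫⁻ x in B, ENNReal.ofReal (Phi n p x (lam.toReal)⁻¹) := by
  rw [← lintegral_indicator hB]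
  congr 1 with x
  by_cases hx : x ∈ B
  · simp [PhiE, chi, hx, h0.ne', ENNReal.toReal_inv]
  · simp [PhiE, chi, hx, Phi]

lemma ofReal_inv_rpow_mul_rpow {p : ℝ} (hp : 0 ≤ p) {lam : ℝ≥0∞} (h0 : 0 < lam)
    (htop : lam ≠ ⊤) : ENNReal.ofReal ((lam.toReal)⁻¹ ^ p) * lam ^ p = 1 := by
  rw [← ENNReal.ofReal_rpow_of_nonneg (by positivity) hp, ← ENNReal.toReal_inv,
    ENNReal.ofReal_toReal (ENNReal.inv_ne_top.mpr h0.ne'), ← ENNReal.mul_rpow_of_nonneg _ _ hp,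
    ENNReal.inv_mul_cancel h0.ne' htop, ENNReal.one_rpow]

lemma luxPhiNorm_chi_le {n : ℕ} {p : ℝ} (hp0 : 0 < p) (hp1 : p < 1) {B : Set (Rn n)}
    (hB : MeasurableSet B) :
    luxPhiNorm n p (chi n B) ≤ (∫⁻ x in B, ENNReal.ofReal (Wp n p x)) ^ (1 / p) := by
  refine le_of_forall_gt_imp_ge_of_dense fun lam hlam => ?_
  rcases eq_or_ne lam ⊤ with rfl | htop
  · exact le_top
  have h0 : 0 < lam := pos_of_gt hlam
  refine sInf_le ⟨h0, ?_⟩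
  have ht : 0 < (lam.toReal)⁻¹ := inv_pos.mpr (ENNReal.toReal_pos h0.ne' htop)
  rw [lintegral_PhiE_chi p hB h0]
  have hI : ∫⁻ x in B, ENNReal.ofReal (Wp n p x) ≤ lam ^ p := by
    rw [one_div] at hlam
    exact (ENNReal.rpow_inv_le_iff hp0).mp hlam.le
  calc ∫⁻ x in B, ENNReal.ofReal (Phi n p x (lam.toReal)⁻¹)
      ≤ ∫⁻ x in B, ENNReal.ofReal ((lam.toReal)⁻¹ ^ p) * ENNReal.ofReal (Wp n p x) := by
        refine lintegral_mono fun x => ?_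
        rw [← ENNReal.ofReal_mul (by positivity)]
        exact ENNReal.ofReal_le_ofReal (Phi_le hp1 x ht)
    _ = ENNReal.ofReal ((lam.toReal)⁻¹ ^ p) * ∫⁻ x in B, ENNReal.ofReal (Wp n p x) :=
        lintegral_const_mul' _ _ ENNReal.ofReal_ne_top
    _ ≤ ENNReal.ofReal ((lam.toReal)⁻¹ ^ p) * lam ^ p := by gcongr
    _ = 1 := ofReal_inv_rpow_mul_rpow hp0.le h0 htop

lemma lintegral_Wp_rpow_le {n : ℕ} (hn : 1 ≤ n) {p : ℝ} (hp0 : 0 < p) (hp1 : p < 1)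
    {B : Set (Rn n)} (hB : MeasurableSet B) {lam : ℝ≥0∞} (h0 : 0 < lam) (htop : lam ≠ ⊤)
    (hlam : ∫⁻ x, PhiE n p x (chi n B x / lam) ≤ 1) :
    (∫⁻ x in B, ENNReal.ofReal (Wp n p x)) ^ (1 / p) ≤
      ((∫⁻ y, ballPow n p y) + ENNReal.ofReal (4 / (1 - p) + 1)) ^ (1 / p) * lam := by
  have ht : 0 < (lam.toReal)⁻¹ := inv_pos.mpr (ENNReal.toReal_pos h0.ne' htop)
  rw [lintegral_PhiE_chi p hB h0] at hlam
  have key := rpow_mul_lintegral_Wp_le hn hp0 hp1 B ht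
  grw [hlam, mul_one] at key
  rw [one_div, ENNReal.rpow_inv_le_iff hp0, ENNReal.mul_rpow_of_nonneg _ _ hp0.le,
    ENNReal.rpow_inv_rpow hp0.ne']
  grw [← key]
  rw [mul_right_comm, ofReal_inv_rpow_mul_rpow hp0.le h0 htop, one_mul]

/-- For `p ∈ (0,1)`, `‖χ_B‖_{L^p_{W_p}} = (∫_B W_p)^{1/p} ∼ ‖χ_B‖_{L^{Φ_p}}`. -/
theorem statement9 (n : ℕ) (hn : 1 ≤ n) (p : ℝ) (hp0 : 0 < p) (hp1 : p < 1) :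
    ∃ C : ℝ≥0∞, 1 ≤ C ∧ C ≠ ⊤ ∧ ∀ (c : Rn n) (r : ℝ), 0 < r →
      C⁻¹ * luxPhiNorm n p (chi n (Metric.ball c r)) ≤
        (∫⁻ x in Metric.ball c r, ENNReal.ofReal (Wp n p x)) ^ (1 / p) ∧
      (∫⁻ x in Metric.ball c r, ENNReal.ofReal (Wp n p x)) ^ (1 / p) ≤
        C * luxPhiNorm n p (chi n (Metric.ball c r)) := by
  set D := ((∫⁻ y, ballPow n p y) + ENNReal.ofReal (4 / (1 - p) + 1)) ^ (1 / p)
  have hK : 1 ≤ 4 / (1 - p) + 1 :=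
    le_add_of_nonneg_left (div_nonneg (by norm_num) (by linarith))
  have hD1 : 1 ≤ D := by
    refine ENNReal.one_le_rpow (le_add_left ?_) (by positivity)
    rwa [ENNReal.one_le_ofReal]
  have hDtop : D ≠ ⊤ := ENNReal.rpow_ne_top_of_nonneg (by positivity)
    (ENNReal.add_ne_top.mpr ⟨lintegral_ballPow_ne_top hn hp0, ENNReal.ofReal_ne_top⟩)
  have hD0 : D ≠ 0 := (zero_lt_one.trans_le hD1).ne'
  refine ⟨D, hD1, hDtop, fun c r _ => ⟨?_, ?_⟩⟩
  · exact (mul_le_of_le_one_left' (ENNReal.inv_le_one.mpr hD1)).trans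
      (luxPhiNorm_chi_le hp0 hp1 measurableSet_ball)
  · rw [mul_comm, ← ENNReal.div_le_iff hD0 hDtop]
    refine le_sInf fun lam ⟨h0, hlam⟩ => ?_
    rcases eq_or_ne lam ⊤ with rfl | htop
    · exact le_top
    rw [ENNReal.div_le_iff hD0 hDtop, mul_comm]
    exact lintegral_Wp_rpow_le hn hp0 hp1 measurableSet_ball h0 htop hlam
end
end
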